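/- For all integers h, k, n with n > 0, k > 0 and q₁q₂ | k, one has Σ_{a,d > 0, ad = n, gcd(a, q₁q₂) = 1} ψ(a) Σ_{b = 0}^{d−1} S_{χ₁,χ₂}(ah + bk, dk) = ρ_{χ₁,χ₂}(n)·S_{χ₁,χ₂}(h,k), where ρ_{χ₁,χ₂}(n) = Σ_{d | n} χ₁(n/d)·χ̄₂(d)·d. (The condition gcd(a, q₁q₂) = 1 is equivalent to keeping only terms where ψ(a) ≠ 0, since ψ vanishes on non-units.) -/

import Mathlib

open scoped BigOperators

/-- The sawtooth (first Bernoulli) function `B₁`. -/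
noncomputable def sawtooth (x : ℝ) : ℝ :=
  open scoped Classical in
  if ∃ n : ℤ, x = (n : ℝ) then 0 else x - ⌊x⌋ - 1 / 2

/-- The newform Dedekind sum `S_{χ₁,χ₂}(h,k)`. -/
noncomputable def newformDedekindSum {q₁ q₂ : ℕ} (χ₁ : DirichletCharacter ℂ q₁)
    (χ₂ : DirichletCharacter ℂ q₂) (h k : ℤ) : ℂ :=
  ∑ j ∈ Finset.range k.toNat, ∑ n ∈ Finset.range q₁,
    (starRingEnd ℂ) (χ₂ (j : ZMod q₂)) * (starRingEnd ℂ) (χ₁ (n : ZMod q₁)) *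
      (sawtooth ((j : ℝ) / (k : ℝ)) : ℝ) *
      (sawtooth ((n : ℝ) / (q₁ : ℝ) + (h : ℝ) * (j : ℝ) / (k : ℝ)) : ℝ)

theorem sum_range_mul_eq {M : Type*} [AddCommMonoid M] (f : ℕ → M) (s k : ℕ) :
    ∑ i ∈ Finset.range (s * k), f i =
      ∑ l ∈ Finset.range s, ∑ i ∈ Finset.range k, f (l * k + i) := by
  induction s with
  | zero => simp
  | succ s ih => rw [Nat.succ_mul, Finset.sum_range_add, ih, Finset.sum_range_succ]

theorem sum_range_natCast_zmod {M : Type*} [AddCommMonoid M] (m : ℕ) [NeZero m]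
    (f : ZMod m → M) : ∑ b ∈ Finset.range m, f (b : ZMod m) = ∑ z, f z := by
  refine Finset.sum_nbij' (fun b => (b : ZMod m)) ZMod.val ?_ ?_ ?_ ?_ ?_
  · simp
  · intro z _; simpa using ZMod.val_lt z
  · intro b hb; exact ZMod.val_cast_of_lt (by simpa using hb)
  · simp
  · simp

theorem Function.Periodic.apply_add_val_div {F : ℝ → ℂ} (hF : Function.Periodic F 1) (m : ℕ)
    [NeZero m] (y : ℝ) (b : ℕ) :
    F (y + ((b : ZMod m).val : ℝ) / m) = F (y + (b : ℝ) / m) := by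
  have hm : (m : ℝ) ≠ 0 := Nat.cast_ne_zero.mpr (NeZero.ne m)
  have h : (b : ℝ) = ((b % m : ℕ) : ℝ) + m * ((b / m : ℕ) : ℝ) := by
    exact_mod_cast (Nat.mod_add_div b m).symm
  rw [ZMod.val_natCast, h, add_div, mul_div_cancel_left₀ _ hm, ← add_assoc]
  simpa using (hF.nat_mul (b / m) (y + ((b % m : ℕ) : ℝ) / m)).symm

theorem sawtooth_periodic : Function.Periodic sawtooth 1 := by
  intro x
  have h : (∃ n : ℤ, x + 1 = (n : ℝ)) ↔ ∃ n : ℤ, x = (n : ℝ) := by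
    constructor
    · rintro ⟨n, hn⟩
      exact ⟨n - 1, by push_cast; linarith⟩
    · rintro ⟨n, hn⟩
      exact ⟨n + 1, by push_cast; linarith⟩
  by_cases hx : ∃ n : ℤ, x = (n : ℝ)
  · rw [sawtooth, sawtooth, if_pos (h.mpr hx), if_pos hx]
  · rw [sawtooth, sawtooth, if_neg (mt h.mp hx), if_neg hx, Int.floor_add_one]
    push_cast
    ring

theorem sawtooth_zero : sawtooth 0 = 0 := if_pos ⟨0, by simp⟩

theorem sawtooth_eq_of_mem_Ioo {x : ℝ} (h0 : 0 < x) (h1 : x < 1) :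
    sawtooth x = x - 1 / 2 := by
  have hfl : ⌊x⌋ = 0 := Int.floor_eq_zero_iff.mpr ⟨h0.le, h1⟩
  unfold sawtooth
  rw [if_neg, hfl]
  · simp
  · rintro ⟨n, rfl⟩
    have h0' : 0 < n := by exact_mod_cast h0
    have h1' : n < 1 := by exact_mod_cast h1
    omega

theorem Function.Periodic.sum_range_add_div_periodic {P : ℝ → ℝ} (hP : Function.Periodic P 1)
    {m : ℕ} (hm : 0 < m) :
    Function.Periodic (fun x => ∑ b ∈ Finset.range m, P (x + (b : ℝ) / m)) (1 / m) := by
  intro x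
  have hm' : (m : ℝ) ≠ 0 := by positivity
  have h1 := Finset.sum_range_succ (fun b : ℕ => P (x + (b : ℝ) / m)) m
  have h2 := Finset.sum_range_succ' (fun b : ℕ => P (x + (b : ℝ) / m)) m
  rw [h1, div_self hm', hP x] at h2
  simp only [Nat.cast_zero, zero_div, add_zero] at h2
  refine (add_right_cancel (b := P x) ?_).symm
  rw [h2]
  congr 1
  refine Finset.sum_congr rfl fun b _ => ?_
  push_cast
  ring_nf

theorem sum_range_cast_real (m : ℕ) :
    ∑ b ∈ Finset.range m, (b : ℝ) = (m : ℝ) * (m - 1) / 2 := by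
  induction m with
  | zero => simp
  | succ m ih => rw [Finset.sum_range_succ, ih]; push_cast; ring

theorem sum_sawtooth_add_div {m : ℕ} (hm : 0 < m) (x : ℝ) :
    ∑ b ∈ Finset.range m, sawtooth (x + (b : ℝ) / m) = sawtooth (m * x) := by
  have hm' : (0 : ℝ) < m := by positivity
  have hx : x - ⌊(m : ℝ) * x⌋ * (1 / (m : ℝ)) = Int.fract ((m : ℝ) * x) / m := by
    rw [Int.fract]; field_simp
  have hper := (sawtooth_periodic.sum_range_add_div_periodic hm).sub_int_mul_eq
    (x := x) ⌊(m : ℝ) * x⌋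
  simp only [hx] at hper
  rw [← hper]
  have hper2 : sawtooth (m * x) = sawtooth (Int.fract (m * x)) := by
    have := sawtooth_periodic.sub_int_mul_eq (x := m * x) ⌊(m : ℝ) * x⌋
    rw [mul_one] at this
    exact this.symm
  rw [hper2]
  have h0 := Int.fract_nonneg ((m : ℝ) * x)
  have h1 := Int.fract_lt_one ((m : ℝ) * x)
  generalize Int.fract ((m : ℝ) * x) = y at h0 h1
  have hlt : ∀ b ∈ Finset.range m, y / m + (b : ℝ) / m < 1 := by
    intro b hb
    have hb' : (b : ℝ) + 1 ≤ m := by exact_mod_cast Finset.mem_range.mp hb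
    rw [← add_div, div_lt_one hm']
    linarith
  rcases h0.eq_or_lt with rfl | hy
  · obtain ⟨r, rfl⟩ : ∃ r, m = r + 1 := ⟨m - 1, by omega⟩
    rw [Finset.sum_range_succ']
    have : ∀ b ∈ Finset.range r, sawtooth (0 / ((r + 1 : ℕ) : ℝ) + ((b + 1 : ℕ) : ℝ) / ((r + 1 : ℕ) : ℝ))
        = (b + 1 : ℝ) / (r + 1) - 1 / 2 := by
      intro b hb
      rw [sawtooth_eq_of_mem_Ioo (by positivity) (hlt _ (by simpa using hb))]
      push_cast
      ring
    rw [Finset.sum_congr rfl this, Finset.sum_sub_distrib, ← Finset.sum_div,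
      Finset.sum_add_distrib, sum_range_cast_real]
    simp [sawtooth_zero]
    field_simp
    ring
  · rw [sawtooth_eq_of_mem_Ioo hy h1]
    have : ∀ b ∈ Finset.range m, sawtooth (y / m + (b : ℝ) / m) = y / m + (b : ℝ) / m - 1 / 2 :=
      fun b hb => sawtooth_eq_of_mem_Ioo (by positivity) (hlt b hb)
    rw [Finset.sum_congr rfl this, Finset.sum_sub_distrib, Finset.sum_add_distrib,
      ← Finset.sum_div, ← Finset.sum_div, sum_range_cast_real]
    simp
    field_simp
    ring

theorem exists_unit_fixing_of_isPrimitive {q : ℕ} [NeZero q] {χ : DirichletCharacter ℂ q}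
    (hχ : χ.IsPrimitive) {m : ZMod q} (hm : ¬ IsUnit m) :
    ∃ u : (ZMod q)ˣ, u * m = m ∧ χ u ≠ 1 := by
  have hq : 0 < q := Nat.pos_of_ne_zero (NeZero.ne q)
  have hg : 1 < Nat.gcd m.val q := by
    have h0 : 0 < Nat.gcd m.val q := Nat.gcd_pos_of_pos_right _ hq
    have h1 : Nat.gcd m.val q ≠ 1 := fun h => hm <| by
      rw [← ZMod.natCast_zmod_val m]
      exact (ZMod.isUnit_iff_coprime _ _).mpr h
    omega
  obtain ⟨d, hd⟩ := Nat.gcd_dvd_right m.val q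
  obtain ⟨r, hr⟩ := Nat.gcd_dvd_left m.val q
  have hdq : d ∣ q := Dvd.intro_left _ hd.symm
  have hd0 : 0 < d := Nat.pos_of_dvd_of_pos hdq hq
  have hlt : d < q := by
    conv_rhs => rw [hd]
    exact lt_mul_left hd0 hg
  have hnf : ¬ χ.FactorsThrough d := fun h => by
    have h1 : χ.conductor ≤ d := Nat.sInf_le h
    rw [DirichletCharacter.isPrimitive_def] at hχ
    omega
  rw [DirichletCharacter.factorsThrough_iff_ker_unitsMap hdq, SetLike.not_le_iff_exists] at hnf
  obtain ⟨u, hu, hχu⟩ := hnf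
  refine ⟨u, ?_, fun h => hχu ?_⟩
  · have hdvd : (d : ℤ) ∣ (u.val.val - 1 : ℤ) := by
      rw [MonoidHom.mem_ker, ← Units.val_inj, Units.val_one, ZMod.unitsMap_def,
        Units.coe_map] at hu
      have : ZMod.castHom hdq (ZMod d) u.val = ((u.val.val : ℤ) : ZMod d) := by simp
      rwa [MonoidHom.coe_coe, this, ← Int.cast_one, eq_comm,
        ZMod.intCast_eq_intCast_iff_dvd_sub] at hu
    obtain ⟨a, ha⟩ := hdvd
    have h1 : u.val - 1 = (d : ZMod q) * (a : ZMod q) := by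
      have : u.val - 1 = ((u.val.val - 1 : ℤ) : ZMod q) := by simp
      rw [this, ha]
      push_cast
      rfl
    have h2 : (d : ZMod q) * m = 0 := by
      rw [← ZMod.natCast_zmod_val m, hr, ← Nat.cast_mul, ZMod.natCast_eq_zero_iff]
      refine ⟨r, ?_⟩
      conv_rhs => rw [hd]
      ring
    linear_combination m * h1 + (a : ZMod q) * h2
  · rw [MonoidHom.mem_ker, ← Units.val_inj]
    simpa using h

theorem sum_conj_mul_apply_mul {q : ℕ} [NeZero q] {χ : DirichletCharacter ℂ q}
    (hχ : χ.IsPrimitive) (G : ZMod q → ℂ) (m : ZMod q) :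
    ∑ z, (starRingEnd ℂ) (χ z) * G (m * z) = χ m * ∑ z, (starRingEnd ℂ) (χ z) * G z := by
  have hsub : ∀ (u : (ZMod q)ˣ) (H : ZMod q → ℂ),
      (starRingEnd ℂ) (χ u) * ∑ z, (starRingEnd ℂ) (χ z) * H (u * z) =
        ∑ z, (starRingEnd ℂ) (χ z) * H z := by
    intro u H
    rw [Finset.mul_sum, ← Equiv.sum_comp u.mulLeft fun z => (starRingEnd ℂ) (χ z) * H z]
    refine Finset.sum_congr rfl fun z _ => ?_
    simp [mul_assoc]
  by_cases hm : IsUnit m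
  · obtain ⟨u, rfl⟩ := hm
    rw [← hsub u G, ← mul_assoc, Complex.mul_conj, Complex.normSq_eq_norm_sq,
      χ.unit_norm_eq_one]
    simp
  · rw [χ.map_nonunit hm, zero_mul]
    obtain ⟨u, hum, hu⟩ := exists_unit_fixing_of_isPrimitive hχ hm
    have h := hsub u fun z => G (m * z)
    have hmul : ∀ z, m * (u * z) = m * z := fun z => by
      rw [← mul_assoc, mul_comm m, hum]
    simp only [hmul] at h
    by_contra hne
    have h1 : (starRingEnd ℂ) (χ u) = 1 := mul_right_cancel₀ hne (by rw [h, one_mul])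
    exact hu (by simpa using congrArg (starRingEnd ℂ) h1)

/-- The sawtooth function averaged against the conjugate of a Dirichlet character. -/
noncomputable def twistedSawtooth {q : ℕ} (χ : DirichletCharacter ℂ q) (x : ℝ) : ℂ :=
  ∑ n ∈ Finset.range q,
    (starRingEnd ℂ) (χ (n : ZMod q)) * (sawtooth ((n : ℝ) / (q : ℝ) + x) : ℝ)

theorem twistedSawtooth_periodic {q : ℕ} (χ : DirichletCharacter ℂ q) :
    Function.Periodic (twistedSawtooth χ) 1 := fun x => by
  simp only [twistedSawtooth, ← add_assoc, sawtooth_periodic _]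

theorem ofReal_sawtooth_periodic : Function.Periodic (fun x => (sawtooth x : ℂ)) 1 :=
  fun x => by simp only [sawtooth_periodic x]

theorem sum_twistedSawtooth_add_div {q : ℕ} [NeZero q] {χ : DirichletCharacter ℂ q}
    (hχ : χ.IsPrimitive) {m : ℕ} (hm : 0 < m) (x : ℝ) :
    ∑ b ∈ Finset.range m, twistedSawtooth χ (x + (b : ℝ) / m) =
      χ (m : ZMod q) * twistedSawtooth χ (m * x) := by
  have hval : ∀ (y : ℝ) (n : ℕ), (sawtooth (((n : ZMod q).val : ℝ) / q + y) : ℂ) =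
      sawtooth ((n : ℝ) / q + y) := fun y n => by
    simpa only [add_comm y] using ofReal_sawtooth_periodic.apply_add_val_div q y n
  have hm' : (m : ℝ) ≠ 0 := by positivity
  have key := sum_conj_mul_apply_mul hχ
    (fun z : ZMod q => (sawtooth ((z.val : ℝ) / q + m * x) : ℂ)) (m : ZMod q)
  rw [← sum_range_natCast_zmod, ← sum_range_natCast_zmod] at key
  simp only [← Nat.cast_mul, hval] at key
  rw [twistedSawtooth, ← key]
  simp only [twistedSawtooth]
  rw [Finset.sum_comm]
  refine Finset.sum_congr rfl fun n _ => ?_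
  rw [← Finset.mul_sum]
  congr 1
  have h := sum_sawtooth_add_div hm ((n : ℝ) / q + x)
  rw [← Complex.ofReal_sum]
  simp only [← add_assoc]
  rw [h]
  push_cast
  ring_nf

theorem Function.Periodic.sum_range_add_mul_div_of_coprime {F : ℝ → ℂ}
    (hF : Function.Periodic F 1) {e j : ℕ} (he : 0 < e) (hj : Nat.Coprime j e) (y : ℝ) :
    ∑ b ∈ Finset.range e, F (y + ((b * j : ℕ) : ℝ) / e) =
      ∑ b ∈ Finset.range e, F (y + (b : ℝ) / e) := by
  have : NeZero e := ⟨he.ne'⟩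
  have h := fun f : ZMod e → ℂ => sum_range_natCast_zmod e f
  have h1 := h fun z => F (y + (z.val : ℝ) / e)
  have h2 := h fun z => F (y + ((z * (ZMod.unitOfCoprime j hj : ZMod e)).val : ℝ) / e)
  simp only [ZMod.coe_unitOfCoprime, ← Nat.cast_mul, hF.apply_add_val_div] at h1 h2
  rw [h1, h2,
    ← Equiv.sum_comp (ZMod.unitOfCoprime j hj).mulRight fun z => F (y + (z.val : ℝ) / e)]
  simp

theorem sum_twistedSawtooth_add_mul_div {q : ℕ} [NeZero q] {χ : DirichletCharacter ℂ q}
    (hχ : χ.IsPrimitive) {d : ℕ} (hd : 0 < d) (j : ℕ) (y : ℝ) :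
    ∑ b ∈ Finset.range d, twistedSawtooth χ (y + (b : ℝ) * j / d) =
      (Nat.gcd j d : ℂ) * χ ((d / Nat.gcd j d : ℕ) : ZMod q) *
        twistedSawtooth χ ((d / Nat.gcd j d : ℕ) * y) := by
  have hF := twistedSawtooth_periodic χ
  have hg : 0 < Nat.gcd j d := Nat.gcd_pos_of_pos_right _ hd
  obtain ⟨g, j', e, hg0, hco, rfl, rfl⟩ := Nat.exists_coprime' (m := j) (n := d) hg
  rw [Nat.gcd_mul_right, hco.gcd_eq_one, one_mul, Nat.mul_div_cancel _ hg0] at *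
  have he : 0 < e := Nat.pos_of_mul_pos_right hd
  have hg' : (g : ℝ) ≠ 0 := by positivity
  have he' : (e : ℝ) ≠ 0 := by positivity
  rw [mul_comm e g, sum_range_mul_eq, mul_assoc, ← sum_twistedSawtooth_add_div hχ he,
    ← hF.sum_range_add_mul_div_of_coprime he hco, ← nsmul_eq_mul, ← Finset.card_range g,
    ← Finset.sum_const, Finset.card_range]
  refine Finset.sum_congr rfl fun l _ => Finset.sum_congr rfl fun b _ => ?_
  rw [← (hF.nat_mul (l * j')) (y + ((b * j' : ℕ) : ℝ) / e)]
  congr 1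
  push_cast
  field_simp
  ring

open ArithmeticFunction in
theorem sum_divisors_moebius_complex (m : ℕ) :
    ∑ i ∈ m.divisors, (moebius i : ℂ) = if m = 1 then 1 else 0 := by
  have h := congrArg (fun f : ArithmeticFunction ℤ => f m) moebius_mul_coe_zeta
  simp only [coe_mul_zeta_apply, one_apply] at h
  exact_mod_cast h

open ArithmeticFunction in
theorem sum_moebius_mul_ite_dvd {e : ℕ} (he : 0 < e) (j : ℕ) :
    ∑ r ∈ e.divisorsAntidiagonal, (moebius r.1 : ℂ) * (if r.1 ∣ j then 1 else 0) =
      if Nat.gcd j e = 1 then 1 else 0 := by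
  rw [Nat.sum_divisorsAntidiagonal (fun t _ => (moebius t : ℂ) * (if t ∣ j then 1 else 0)),
    ← sum_divisors_moebius_complex]
  simp only [mul_ite, mul_one, mul_zero]
  rw [← Finset.sum_filter]
  refine Finset.sum_congr ?_ fun _ _ => rfl
  ext t
  simp only [Finset.mem_filter, Nat.mem_divisors, Nat.dvd_gcd_iff]
  have hne : Nat.gcd j e ≠ 0 := (Nat.gcd_pos_of_pos_right _ he).ne'
  simp [hne, he.ne', and_comm]

theorem eq_gcd_iff_of_mul_eq {g e d : ℕ} (hd : 0 < d) (h : g * e = d) (j : ℕ) :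
    g = Nat.gcd j d ↔ g ∣ j ∧ Nat.gcd (j / g) e = 1 := by
  subst h
  have hg : 0 < g := Nat.pos_of_mul_pos_right hd
  constructor
  · intro h
    have hgj : g ∣ j := h ▸ Nat.gcd_dvd_left _ _
    refine ⟨hgj, ?_⟩
    obtain ⟨c, rfl⟩ := hgj
    rw [Nat.gcd_mul_left] at h
    rw [Nat.mul_div_cancel_left _ hg]
    exact (Nat.eq_of_mul_eq_mul_left hg (by omega)).symm
  · rintro ⟨⟨c, rfl⟩, h⟩
    rw [Nat.mul_div_cancel_left _ hg] at h
    rw [Nat.gcd_mul_left, h, mul_one]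

open ArithmeticFunction in
theorem apply_gcd_eq_sum_moebius {d : ℕ} (hd : 0 < d) (j : ℕ) (f : ℕ → ℂ) :
    f (Nat.gcd j d) = ∑ p ∈ d.divisorsAntidiagonal, ∑ r ∈ p.2.divisorsAntidiagonal,
      (moebius r.1 : ℂ) * (if p.1 * r.1 ∣ j then f p.1 else 0) := by
  have key : ∀ p ∈ d.divisorsAntidiagonal, ∑ r ∈ p.2.divisorsAntidiagonal,
      (moebius r.1 : ℂ) * (if p.1 * r.1 ∣ j then f p.1 else 0) =
        if p.1 = Nat.gcd j d then f p.1 else 0 := by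
    intro p hp
    rw [Nat.mem_divisorsAntidiagonal] at hp
    have he : 0 < p.2 := Nat.pos_of_ne_zero fun h => by simp [h] at hp; omega
    have hg : 0 < p.1 := Nat.pos_of_ne_zero fun h => by simp [h] at hp; omega
    rw [if_congr (eq_gcd_iff_of_mul_eq hd hp.1 j) rfl rfl]
    by_cases hgj : p.1 ∣ j
    · obtain ⟨c, rfl⟩ := hgj
      have h := sum_moebius_mul_ite_dvd he c
      simp only [Nat.mul_dvd_mul_iff_left hg, Nat.mul_div_cancel_left _ hg, dvd_mul_right,
        true_and]
      rw [show (if Nat.gcd c p.2 = 1 then f p.1 else 0) =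
        (if Nat.gcd c p.2 = 1 then 1 else 0) * f p.1 by simp, ← h, Finset.sum_mul]
      refine Finset.sum_congr rfl fun r _ => ?_
      split_ifs <;> simp
    · have h : ∀ t, ¬ p.1 * t ∣ j := fun t ht => hgj (dvd_of_mul_right_dvd ht)
      simp [hgj, h]
  rw [Finset.sum_congr rfl key,
    Nat.sum_divisorsAntidiagonal (fun g _ => if g = Nat.gcd j d then f g else 0),
    Finset.sum_ite_eq' d.divisors (Nat.gcd j d) f, if_pos]
  exact Nat.mem_divisors.mpr ⟨Nat.gcd_dvd_right _ _, hd.ne'⟩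

theorem sum_range_mul_ite_dvd {M : Type*} [AddCommMonoid M] (N : ℕ) {c : ℕ} (hc : 0 < c)
    (f : ℕ → M) : ∑ j ∈ Finset.range (N * c), (if c ∣ j then f j else 0) =
      ∑ i ∈ Finset.range N, f (c * i) := by
  rw [sum_range_mul_eq]
  refine Finset.sum_congr rfl fun l _ => ?_
  rw [Finset.sum_eq_single 0]
  · simp [mul_comm]
  · intro i hi hi0
    refine if_neg fun h => hi0 ?_
    rw [Nat.dvd_add_right (Dvd.intro_left l rfl)] at h
    exact Nat.eq_zero_of_dvd_of_lt h (Finset.mem_range.mp hi)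
  · intro h
    exact absurd (Finset.mem_range.mpr hc) h

open ArithmeticFunction in
theorem sum_range_apply_gcd {d : ℕ} (hd : 0 < d) (k : ℕ) (f : ℕ → ℕ → ℂ) :
    ∑ j ∈ Finset.range (d * k), f j (Nat.gcd j d) =
      ∑ p ∈ d.divisorsAntidiagonal, ∑ r ∈ p.2.divisorsAntidiagonal,
        (moebius r.1 : ℂ) * ∑ i ∈ Finset.range (r.2 * k), f (p.1 * r.1 * i) p.1 := by
  rw [Finset.sum_congr rfl fun j _ => apply_gcd_eq_sum_moebius hd j (f j), Finset.sum_comm]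
  refine Finset.sum_congr rfl fun p hp => ?_
  rw [Finset.sum_comm]
  refine Finset.sum_congr rfl fun r hr => ?_
  rw [← Finset.mul_sum]
  congr 1
  rw [Nat.mem_divisorsAntidiagonal] at hp hr
  have hpos : 0 < p.1 * r.1 := Nat.pos_of_ne_zero fun h => by
    rw [← hr.1, ← mul_assoc, h, zero_mul] at hp
    omega
  rw [← sum_range_mul_ite_dvd _ hpos fun j => f j p.1]
  congr 2
  rw [← hp.1, ← hr.1]
  ring

theorem sum_divisorsAntidiagonal_assoc {M : Type*} [AddCommMonoid M] (n : ℕ)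
    (f : ℕ → ℕ → ℕ → M) :
    ∑ p ∈ n.divisorsAntidiagonal, ∑ r ∈ p.2.divisorsAntidiagonal, f p.1 r.1 r.2 =
      ∑ p ∈ n.divisorsAntidiagonal, ∑ r ∈ p.1.divisorsAntidiagonal, f r.1 r.2 p.2 := by
  rw [Finset.sum_sigma', Finset.sum_sigma']
  refine Finset.sum_nbij' (fun x => ⟨(x.1.1 * x.2.1, x.2.2), (x.1.1, x.2.1)⟩)
    (fun x => ⟨(x.2.1, x.2.2 * x.1.2), (x.2.2, x.1.2)⟩) ?_ ?_ ?_ ?_ ?_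
  · rintro ⟨⟨a, e⟩, b, c⟩ hx
    simp only [Finset.mem_sigma, Nat.mem_divisorsAntidiagonal] at hx ⊢
    obtain ⟨⟨rfl, hn⟩, rfl, he⟩ := hx
    simp_all [mul_assoc]
  · rintro ⟨⟨m, c⟩, a, b⟩ hx
    simp only [Finset.mem_sigma, Nat.mem_divisorsAntidiagonal] at hx ⊢
    obtain ⟨⟨rfl, hn⟩, rfl, he⟩ := hx
    simp_all [mul_assoc]
  · rintro ⟨⟨a, e⟩, b, c⟩ hx
    simp only [Finset.mem_sigma, Nat.mem_divisorsAntidiagonal] at hx ⊢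
    obtain ⟨⟨rfl, hn⟩, rfl, he⟩ := hx
    rfl
  · rintro ⟨⟨m, c⟩, a, b⟩ hx
    simp only [Finset.mem_sigma, Nat.mem_divisorsAntidiagonal] at hx ⊢
    obtain ⟨⟨rfl, hn⟩, rfl, he⟩ := hx
    rfl
  · intros
    rfl

theorem sum_divisorsAntidiagonal_left_comm {M : Type*} [AddCommMonoid M] (n : ℕ)
    (f : ℕ → ℕ → ℕ → M) :
    ∑ p ∈ n.divisorsAntidiagonal, ∑ r ∈ p.2.divisorsAntidiagonal, f p.1 r.1 r.2 =
      ∑ p ∈ n.divisorsAntidiagonal, ∑ r ∈ p.2.divisorsAntidiagonal, f r.1 p.1 r.2 := by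
  rw [sum_divisorsAntidiagonal_assoc, sum_divisorsAntidiagonal_assoc n fun a b c => f b a c]
  refine Finset.sum_congr rfl fun p _ => ?_
  conv_lhs => rw [← Nat.map_swap_divisorsAntidiagonal, Finset.sum_map]
  rfl

theorem newformDedekindSum_natCast {q₁ q₂ : ℕ} (χ₁ : DirichletCharacter ℂ q₁)
    (χ₂ : DirichletCharacter ℂ q₂) (h : ℤ) (k : ℕ) :
    newformDedekindSum χ₁ χ₂ h (k : ℤ) = ∑ j ∈ Finset.range k,
      (starRingEnd ℂ) (χ₂ (j : ZMod q₂)) * (sawtooth ((j : ℝ) / k) : ℝ) *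
        twistedSawtooth χ₁ ((h : ℝ) * j / k) := by
  simp only [newformDedekindSum, twistedSawtooth, Int.toNat_natCast, Int.cast_natCast,
    Finset.mul_sum]
  refine Finset.sum_congr rfl fun j _ => Finset.sum_congr rfl fun n _ => ?_
  ring

theorem sum_range_mul_eq_newformDedekindSum {q₁ q₂ : ℕ} (χ₁ : DirichletCharacter ℂ q₁)
    (χ₂ : DirichletCharacter ℂ q₂) {k s : ℕ} (hk : 0 < k) (hs : 0 < s) (hq : q₂ ∣ k) (c : ℤ) :
    ∑ i ∈ Finset.range (s * k), (starRingEnd ℂ) (χ₂ (i : ZMod q₂)) *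
        (sawtooth ((i : ℝ) / ((s : ℝ) * k)) : ℝ) * twistedSawtooth χ₁ ((c : ℝ) * i / k) =
      newformDedekindSum χ₁ χ₂ c (k : ℤ) := by
  have hk' : (k : ℝ) ≠ 0 := by positivity
  have hs' : (s : ℝ) ≠ 0 := by positivity
  have hk0 : (k : ZMod q₂) = 0 := (ZMod.natCast_eq_zero_iff _ _).mpr hq
  rw [newformDedekindSum_natCast, sum_range_mul_eq, Finset.sum_comm]
  refine Finset.sum_congr rfl fun i _ => ?_
  have h1 : ∀ l : ℕ, twistedSawtooth χ₁ ((c : ℝ) * ((l * k + i : ℕ) : ℝ) / k) =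
      twistedSawtooth χ₁ ((c : ℝ) * i / k) := fun l => by
    rw [← ((twistedSawtooth_periodic χ₁).int_mul (c * l)) ((c : ℝ) * i / k)]
    congr 1
    push_cast
    field_simp
    ring
  have h2 : ∀ l : ℕ, ((l * k + i : ℕ) : ZMod q₂) = i := fun l => by
    push_cast
    rw [hk0, mul_zero, zero_add]
  have h3 := sum_sawtooth_add_div hs ((i : ℝ) / (s * k))
  simp only [h1, h2]
  rw [← Finset.sum_mul, ← Finset.mul_sum, ← Complex.ofReal_sum]
  congr 3
  convert h3 using 2
  · refine congrArg sawtooth ?_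
    push_cast
    field_simp
    ring
  · field_simp

open ArithmeticFunction in
theorem sum_range_newformDedekindSum {q₁ q₂ : ℕ} [NeZero q₁] {χ₁ : DirichletCharacter ℂ q₁}
    (hχ₁ : χ₁.IsPrimitive) (χ₂ : DirichletCharacter ℂ q₂) {k d : ℕ} (hk : 0 < k) (hd : 0 < d)
    (hq : q₂ ∣ k) (c : ℤ) :
    ∑ b ∈ Finset.range d, newformDedekindSum χ₁ χ₂ (c + (b : ℤ) * k) ((d : ℤ) * k) =
      ∑ p ∈ d.divisorsAntidiagonal, ∑ r ∈ p.2.divisorsAntidiagonal, (moebius r.1 : ℂ) *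
        ((starRingEnd ℂ) (χ₂ (p.1 : ZMod q₂)) * (starRingEnd ℂ) (χ₂ (r.1 : ZMod q₂)) * p.1 *
          χ₁ (r.1 : ZMod q₁) * χ₁ (r.2 : ZMod q₁) * newformDedekindSum χ₁ χ₂ (r.1 * c) k) := by
  have hk' : (k : ℝ) ≠ 0 := by positivity
  have hd' : (d : ℝ) ≠ 0 := by positivity
  simp only [← Nat.cast_mul d k, newformDedekindSum_natCast χ₁ χ₂ _ (d * k)]
  rw [Finset.sum_comm]
  obtain ⟨f, hf⟩ : ∃ f : ℕ → ℕ → ℂ, ∀ j g, f j g = (starRingEnd ℂ) (χ₂ (j : ZMod q₂)) *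
      (sawtooth ((j : ℝ) / (d * k : ℕ)) : ℝ) * ((g : ℂ) * χ₁ ((d / g : ℕ) : ZMod q₁) *
        twistedSawtooth χ₁ ((d / g : ℕ) * ((c : ℝ) * j / (d * k)))) :=
    ⟨_, fun _ _ => rfl⟩
  have key : ∀ j ∈ Finset.range (d * k), ∑ b ∈ Finset.range d,
      (starRingEnd ℂ) (χ₂ (j : ZMod q₂)) * (sawtooth ((j : ℝ) / (d * k : ℕ)) : ℝ) *
        twistedSawtooth χ₁ (((c + (b : ℤ) * k : ℤ) : ℝ) * j / (d * k : ℕ)) =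
      f j (Nat.gcd j d) := by
    intro j _
    rw [hf, ← sum_twistedSawtooth_add_mul_div hχ₁ hd, Finset.mul_sum]
    refine Finset.sum_congr rfl fun b _ => ?_
    congr 2
    push_cast
    field_simp
  rw [Finset.sum_congr rfl key, sum_range_apply_gcd hd k f]
  simp only [hf]
  refine Finset.sum_congr rfl fun p hp => Finset.sum_congr rfl fun r hr => ?_
  congr 1
  obtain ⟨g, e⟩ := p
  obtain ⟨t, s⟩ := r
  simp only [Nat.mem_divisorsAntidiagonal] at hp hr ⊢
  obtain ⟨rfl, -⟩ := hr
  obtain ⟨rfl, -⟩ := hp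
  have hg : 0 < g := Nat.pos_of_mul_pos_right hd
  have hts : 0 < t * s := Nat.pos_of_mul_pos_left hd
  have ht : 0 < t := Nat.pos_of_mul_pos_right hts
  have hs : 0 < s := Nat.pos_of_mul_pos_left hts
  have hg' : (g : ℝ) ≠ 0 := by positivity
  have ht' : (t : ℝ) ≠ 0 := by positivity
  have hs' : (s : ℝ) ≠ 0 := by positivity
  rw [← sum_range_mul_eq_newformDedekindSum χ₁ χ₂ hk hs hq, Finset.mul_sum,
    Nat.mul_div_cancel_left _ hg]
  refine Finset.sum_congr rfl fun i _ => ?_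
  have h1 : ((g * t * i : ℕ) : ℝ) / ((g * (t * s) * k : ℕ) : ℝ) = (i : ℝ) / (s * k) := by
    push_cast
    field_simp
  have h2 : ((t * s : ℕ) : ℝ) * ((c : ℝ) * ((g * t * i : ℕ) : ℝ) / ((g * (t * s) : ℕ) * k)) =
      ((t * c : ℤ) : ℝ) * i / k := by
    push_cast
    field_simp
  rw [h1, h2]
  push_cast
  simp only [map_mul]
  ring

/-- The generalized Knopp identity for newform Dedekind sums:
`Σ_{ad=n, (a,q₁q₂)=1} ψ(a) Σ_{b mod d} S_{χ₁,χ₂}(ah+bk, dk) = ρ_{χ₁,χ₂}(n) S_{χ₁,χ₂}(h,k)`,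
where `ψ = χ₁ χ̄₂` and `ρ_{χ₁,χ₂}(n) = Σ_{d ∣ n} χ₁(n/d) χ̄₂(d) d`. -/
theorem generalized_knopp_identity {q₁ q₂ : ℕ} (hq₁ : 1 < q₁) (hq₂ : 1 < q₂)
    (χ₁ : DirichletCharacter ℂ q₁) (χ₂ : DirichletCharacter ℂ q₂)
    (hχ₁ : DirichletCharacter.IsPrimitive χ₁) (hχ₂ : DirichletCharacter.IsPrimitive χ₂)
    (hpar : χ₁ (-1) * χ₂ (-1) = 1)
    (h k n : ℤ) (hn : 0 < n) (hk : 0 < k) (hdvd : ((q₁ * q₂ : ℕ) : ℤ) ∣ k) :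
    ∑ p ∈ (Nat.divisorsAntidiagonal n.toNat).filter (fun p => Nat.Coprime p.1 (q₁ * q₂)),
        (χ₁ ((p.1 : ℤ) : ZMod q₁) * (starRingEnd ℂ) (χ₂ ((p.1 : ℤ) : ZMod q₂))) *
          ∑ b ∈ Finset.range p.2,
            newformDedekindSum χ₁ χ₂ ((p.1 : ℤ) * h + (b : ℤ) * k) ((p.2 : ℤ) * k) =
      (∑ p ∈ Nat.divisorsAntidiagonal n.toNat,
          χ₁ ((p.1 : ℤ) : ZMod q₁) * (starRingEnd ℂ) (χ₂ ((p.2 : ℤ) : ZMod q₂)) * (p.2 : ℂ)) *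
        newformDedekindSum χ₁ χ₂ h k := by
  have : NeZero q₁ := ⟨by omega⟩
  lift k to ℕ using hk.le
  lift n to ℕ using hn.le
  have hk' : 0 < k := by exact_mod_cast hk
  have hn' : 0 < n := by exact_mod_cast hn
  have hq : q₂ ∣ k := dvd_trans (dvd_mul_left _ _) (Int.natCast_dvd_natCast.mp hdvd)
  rw [Int.toNat_natCast, Finset.sum_filter_of_ne]
  swap
  · intro p _ hne
    have h1 : IsUnit (p.1 : ZMod q₁) := by
      by_contra hu
      exact hne (by simp [χ₁.map_nonunit hu])
    have h2 : IsUnit (p.1 : ZMod q₂) := by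
      by_contra hu
      exact hne (by simp [χ₂.map_nonunit hu])
    exact Nat.Coprime.mul_right ((ZMod.isUnit_iff_coprime _ _).mp h1)
      ((ZMod.isUnit_iff_coprime _ _).mp h2)
  simp only [Int.cast_natCast]
  have expand : ∀ p ∈ n.divisorsAntidiagonal,
      (χ₁ (p.1 : ZMod q₁) * (starRingEnd ℂ) (χ₂ (p.1 : ZMod q₂))) *
        ∑ b ∈ Finset.range p.2,
          newformDedekindSum χ₁ χ₂ ((p.1 : ℤ) * h + (b : ℤ) * k) ((p.2 : ℤ) * k) =
      ∑ r ∈ p.2.divisorsAntidiagonal, ∑ u ∈ r.2.divisorsAntidiagonal,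
        (starRingEnd ℂ) (χ₂ (r.1 : ZMod q₂)) * r.1 * ((ArithmeticFunction.moebius u.1 : ℂ) *
          ((starRingEnd ℂ) (χ₂ ((p.1 * u.1 : ℕ) : ZMod q₂)) * χ₁ ((p.1 * u.1 : ℕ) : ZMod q₁) *
            χ₁ (u.2 : ZMod q₁) * newformDedekindSum χ₁ χ₂ ((p.1 * u.1 : ℕ) * h) k)) := by
    intro p hp
    rw [sum_range_newformDedekindSum hχ₁ χ₂ hk' (Nat.pos_of_mem_divisors
      (Nat.snd_mem_divisors_of_mem_antidiagonal hp)) hq]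
    simp only [Finset.mul_sum]
    refine Finset.sum_congr rfl fun r _ => Finset.sum_congr rfl fun u _ => ?_
    rw [show (u.1 : ℤ) * ((p.1 : ℤ) * h) = ((p.1 * u.1 : ℕ) : ℤ) * h by push_cast; ring]
    push_cast
    simp only [map_mul]
    ring
  rw [Finset.sum_congr rfl expand, sum_divisorsAntidiagonal_left_comm n fun a g e =>
    ∑ u ∈ e.divisorsAntidiagonal,
      (starRingEnd ℂ) (χ₂ (g : ZMod q₂)) * g * ((ArithmeticFunction.moebius u.1 : ℂ) *
        ((starRingEnd ℂ) (χ₂ ((a * u.1 : ℕ) : ZMod q₂)) * χ₁ ((a * u.1 : ℕ) : ZMod q₁) *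
          χ₁ (u.2 : ZMod q₁) * newformDedekindSum χ₁ χ₂ ((a * u.1 : ℕ) * h) k)),
    Finset.sum_mul]
  conv_rhs => rw [← Nat.map_swap_divisorsAntidiagonal, Finset.sum_map]
  refine Finset.sum_congr rfl fun p hp => ?_
  have he : 0 < p.2 := Nat.pos_of_mem_divisors (Nat.snd_mem_divisors_of_mem_antidiagonal hp)
  rw [sum_divisorsAntidiagonal_assoc p.2 fun a t s =>
    (starRingEnd ℂ) (χ₂ (p.1 : ZMod q₂)) * p.1 * ((ArithmeticFunction.moebius t : ℂ) *
      ((starRingEnd ℂ) (χ₂ ((a * t : ℕ) : ZMod q₂)) * χ₁ ((a * t : ℕ) : ZMod q₁) *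
        χ₁ (s : ZMod q₁) * newformDedekindSum χ₁ χ₂ ((a * t : ℕ) * h) k))]
  have collapse : ∀ r ∈ p.2.divisorsAntidiagonal, ∑ u ∈ r.1.divisorsAntidiagonal,
      (starRingEnd ℂ) (χ₂ (p.1 : ZMod q₂)) * p.1 * ((ArithmeticFunction.moebius u.2 : ℂ) *
        ((starRingEnd ℂ) (χ₂ ((u.1 * u.2 : ℕ) : ZMod q₂)) * χ₁ ((u.1 * u.2 : ℕ) : ZMod q₁) *
          χ₁ (r.2 : ZMod q₁) * newformDedekindSum χ₁ χ₂ ((u.1 * u.2 : ℕ) * h) k)) =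
      if r.1 = 1 then (starRingEnd ℂ) (χ₂ (p.1 : ZMod q₂)) * p.1 *
        (χ₁ (r.2 : ZMod q₁) * newformDedekindSum χ₁ χ₂ h k) else 0 := by
    intro r _
    have hterm : ∀ u ∈ r.1.divisorsAntidiagonal,
        (starRingEnd ℂ) (χ₂ (p.1 : ZMod q₂)) * p.1 * ((ArithmeticFunction.moebius u.2 : ℂ) *
          ((starRingEnd ℂ) (χ₂ ((u.1 * u.2 : ℕ) : ZMod q₂)) * χ₁ ((u.1 * u.2 : ℕ) : ZMod q₁) *
            χ₁ (r.2 : ZMod q₁) * newformDedekindSum χ₁ χ₂ ((u.1 * u.2 : ℕ) * h) k)) =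
        (ArithmeticFunction.moebius u.2 : ℂ) * ((starRingEnd ℂ) (χ₂ (p.1 : ZMod q₂)) * p.1 *
          ((starRingEnd ℂ) (χ₂ (r.1 : ZMod q₂)) * χ₁ (r.1 : ZMod q₁) *
            χ₁ (r.2 : ZMod q₁) * newformDedekindSum χ₁ χ₂ (r.1 * h) k)) := by
      intro u hu
      rw [(Nat.mem_divisorsAntidiagonal.mp hu).1]
      ring
    rw [Finset.sum_congr rfl hterm, ← Finset.sum_mul,
      Nat.sum_divisorsAntidiagonal' (fun _ t => (ArithmeticFunction.moebius t : ℂ)),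
      sum_divisors_moebius_complex]
    split_ifs with h1
    · simp [h1]
    · simp
  rw [Finset.sum_congr rfl collapse, Nat.sum_divisorsAntidiagonal (fun m s => if m = 1 then
    (starRingEnd ℂ) (χ₂ (p.1 : ZMod q₂)) * p.1 *
      (χ₁ (s : ZMod q₁) * newformDedekindSum χ₁ χ₂ h k) else 0),
    Finset.sum_eq_single_of_mem 1 (Nat.one_mem_divisors.mpr he.ne')
      (fun m _ hm => if_neg hm), if_pos rfl, Nat.div_one]
  simp only [Equiv.coe_toEmbedding, Equiv.prodComm_apply, Prod.fst_swap, Prod.snd_swap]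
  ring
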